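/- arXiv:2003.09381 — 6 statements merged into one kernel-verified Lean document; each statement's English description precedes it below -/
import Mathlib

section
/- For every column index j with 0 ≤ j < n − b, the minor μ(b−1, j) of Q_P (the determinant of the (n−1)×(n−1) matrix obtained from Q_P by deleting row b−1 and column j) is a polynomial of total degree exactly n − b. -/
open MvPolynomial Matrix

noncomputable section

/-- The scalar sequence `u`: first `n = m*b` values are `0,…,0,1`, then it follows the
linear recurrence with coefficients `c`. -/
def uSeq (m b : ℕ) (c : Fin (m*b) → ZMod 2) : ℕ → ZMod 2
  | s =>
    if s < m*b then (if s = m*b - 1 then 1 else 0)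
    else ∑ j : Fin (m*b), c j * uSeq m b c (s - m*b + j)
  termination_by s => s
  decreasing_by have := j.isLt; omega

/-- The symbolic sequence `w t`: first `n = m*b` values are the indeterminates `X (t, s)`,
then it follows the linear recurrence with coefficients `c`. -/
def wPoly (m b : ℕ) (c : Fin (m*b) → ZMod 2) (t : Fin (m-1)) :
    ℕ → MvPolynomial ((Fin (m-1)) × ℕ) (ZMod 2)
  | s =>
    if s < m*b then X (t, s)
    else ∑ j : Fin (m*b), C (c j) * wPoly m b c t (s - m*b + j)
  termination_by s => s
  decreasing_by have := j.isLt; omega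

/-- The matrix `Q_P` of Equation (13). -/
def QP (m b : ℕ) (hm : 2 ≤ m) (hb : 1 ≤ b) (c : Fin (m*b) → ZMod 2) :
    Matrix (Fin (m*b)) (Fin (m*b)) (MvPolynomial ((Fin (m-1)) × ℕ) (ZMod 2)) :=
  fun i j =>
    if (i : ℕ) < b then C (uSeq m b c ((i : ℕ) + (j : ℕ)))
    else wPoly m b c
      ⟨((i : ℕ) - b) / b, by
        have hi := i.isLt
        have h2 : 2 * b ≤ m * b := Nat.mul_le_mul hm (le_refl b)
        have h1 : b * (m - 1) = m * b - b := by
          cases m with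
          | zero => simp
          | succ m' => simp [Nat.succ_mul, Nat.mul_comm]
        have : (i : ℕ) - b < b * (m - 1) := by omega
        exact Nat.div_lt_of_lt_mul this⟩
      (((i : ℕ) - b) % b + (j : ℕ))

/-- The map from `Fin (n-1)` to `Fin n` skipping the index `i`. -/
def skipIdx {n : ℕ} (i : Fin n) (k : Fin (n - 1)) : Fin n :=
  if (k : ℕ) < (i : ℕ) then ⟨k, by have := k.isLt; have := i.isLt; omega⟩
  else ⟨(k : ℕ) + 1, by have := k.isLt; have := i.isLt; omega⟩

/-- The minor `μ(i,j)`: determinant of the matrix obtained by deleting row `i` and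
column `j`. -/
def minorQ {n : ℕ} {R : Type*} [CommRing R] (A : Matrix (Fin n) (Fin n) R) (i j : Fin n) : R :=
  (A.submatrix (skipIdx i) (skipIdx j)).det

/-- The bottom-left block `Q₃` of `Q_P`: rows `b,…,n-1` and columns `0,…,n-b-1`. -/
def Q3 (m b : ℕ) (hm : 2 ≤ m) (hb : 1 ≤ b) (c : Fin (m*b) → ZMod 2) :
    Matrix (Fin (m*b - b)) (Fin (m*b - b)) (MvPolynomial ((Fin (m-1)) × ℕ) (ZMod 2)) :=
  fun i j =>
    QP m b hm hb c
      ⟨b + (i : ℕ), by have := i.isLt; omega⟩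
      ⟨(j : ℕ), by have := j.isLt; omega⟩

end

theorem skipIdx_val {n : ℕ} (i : Fin n) (k : Fin (n - 1)) :
    (skipIdx i k : ℕ) = if (k : ℕ) < i then (k : ℕ) else k + 1 := by
  unfold skipIdx
  split_ifs <;> rfl

theorem skipIdx_injective {n : ℕ} (i : Fin n) : Function.Injective (skipIdx i) := by
  intro k l h
  have h' := congrArg Fin.val h
  rw [skipIdx_val, skipIdx_val] at h'
  ext
  split_ifs at h' <;> omega

theorem mem_range_skipIdx_iff {n : ℕ} (i k : Fin n) :
    k ∈ Set.range (skipIdx i) ↔ k ≠ i := by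
  constructor
  · rintro ⟨l, rfl⟩ h
    have h' := congrArg Fin.val h
    rw [skipIdx_val] at h'
    split_ifs at h' <;> omega
  · intro h
    have hne : (k : ℕ) ≠ i := fun e => h (Fin.ext e)
    have hk := k.isLt
    have hi := i.isLt
    rcases lt_or_gt_of_ne hne with hlt | hgt
    · refine ⟨⟨k, by omega⟩, Fin.ext ?_⟩
      rw [skipIdx_val, if_pos hlt]
    · refine ⟨⟨k - 1, by omega⟩, Fin.ext ?_⟩
      rw [skipIdx_val, if_neg (by simp only; omega)]
      simp only
      omega

/-- A minor over a field is nonzero as soon as no nonzero vector supported off the deleted column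
is annihilated by all the remaining rows. -/
theorem minorQ_ne_zero_of_forall {n : ℕ} {K : Type*} [Field K] (A : Matrix (Fin n) (Fin n) K)
    (i j : Fin n)
    (h : ∀ y : Fin n → K, y j = 0 → (∀ l, l ≠ i → ∑ k, A l k * y k = 0) → y = 0) :
    minorQ A i j ≠ 0 := by
  intro hdet
  obtain ⟨v, hv, hAv⟩ := Matrix.exists_mulVec_eq_zero_iff.mpr hdet
  have hinj := skipIdx_injective j
  have hoff : ∀ k, k ∉ Set.range (skipIdx j) → Function.extend (skipIdx j) v 0 k = 0 :=
    fun k hk => Function.extend_apply' _ _ _ hk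
  have hy := h (Function.extend (skipIdx j) v 0)
    (hoff j fun hm => (mem_range_skipIdx_iff j j).mp hm rfl)
    (by
      intro l hl
      obtain ⟨r, rfl⟩ := (mem_range_skipIdx_iff i l).mpr hl
      refine Eq.trans (Fintype.sum_of_injective _ hinj _ _ ?_ ?_).symm (congrFun hAv r)
      · intro k hk
        rw [hoff k hk, mul_zero]
      · intro k
        rw [hinj.extend_apply]
        rfl)
  refine hv (funext fun k => ?_)
  rw [← hinj.extend_apply v 0 k, hy]
  rfl

theorem map_minorQ {n : ℕ} {R S : Type*} [CommRing R] [CommRing S] (f : R →+* S)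
    (A : Matrix (Fin n) (Fin n) R) (i j : Fin n) :
    f (minorQ A i j) = minorQ (A.map f) i j := by
  simp only [minorQ, RingHom.map_det, RingHom.mapMatrix_apply, submatrix_map]

theorem isHomogeneous_det_of_rows {ι σ R : Type*} [Fintype ι] [DecidableEq ι] [CommRing R]
    {A : Matrix ι ι (MvPolynomial σ R)} {d : ι → ℕ} (h : ∀ i k, (A i k).IsHomogeneous (d i)) :
    A.det.IsHomogeneous (∑ i, d i) := by
  rw [← det_transpose, det_apply]
  refine IsHomogeneous.sum _ _ _ fun τ _ => ?_
  have hprod : (∏ i, Aᵀ (τ i) i).IsHomogeneous (∑ i, d i) :=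
    IsHomogeneous.prod _ _ _ fun i _ => h i (τ i)
  rcases Int.units_eq_one_or (Equiv.Perm.sign τ) with hs | hs
  · simpa [hs] using hprod
  · simpa [hs] using hprod.neg

theorem wPoly_isHomogeneous (m b : ℕ) (c : Fin (m*b) → ZMod 2) (t : Fin (m-1)) (s : ℕ) :
    (wPoly m b c t s).IsHomogeneous 1 := by
  induction s using Nat.strong_induction_on with
  | _ s ih =>
    rw [wPoly]
    split_ifs with hs
    · exact isHomogeneous_X _ _
    · refine IsHomogeneous.sum _ _ _ fun l _ => ?_
      have hl := l.isLt
      simpa using (isHomogeneous_C _ (c l)).mul (ih (s - m*b + l) (by omega))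

theorem QP_isHomogeneous (m b : ℕ) (hm : 2 ≤ m) (hb : 1 ≤ b) (c : Fin (m*b) → ZMod 2)
    (i k : Fin (m*b)) :
    (QP m b hm hb c i k).IsHomogeneous (if (i : ℕ) < b then 0 else 1) := by
  unfold QP
  split_ifs
  · exact isHomogeneous_C _ _
  · exact wPoly_isHomogeneous _ _ _ _ _

theorem uSeq_of_lt {m b : ℕ} (c : Fin (m*b) → ZMod 2) {s : ℕ} (hs : s < m*b) :
    uSeq m b c s = if s = m*b - 1 then 1 else 0 := by
  rw [uSeq, if_pos hs]

theorem wPoly_of_lt {m b : ℕ} (c : Fin (m*b) → ZMod 2) (t : Fin (m-1)) {s : ℕ} (hs : s < m*b) :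
    wPoly m b c t s = X (t, s) := by
  rw [wPoly, if_pos hs]

theorem minor_row_b_sub_one_isHomogeneous (m b : ℕ) (hm : 2 ≤ m) (hb : 1 ≤ b)
    (c : Fin (m*b) → ZMod 2) (i j : Fin (m*b)) (hi : (i : ℕ) = b - 1) :
    (minorQ (QP m b hm hb c) i j).IsHomogeneous (m*b - b) := by
  have hdeg : ∑ k : Fin (m*b - 1), (if (skipIdx i k : ℕ) < b then 0 else 1) = m*b - b := by
    have hlt := Nat.mul_le_mul hm (le_refl b)
    have hterm : ∀ k : Fin (m*b - 1), (if (skipIdx i k : ℕ) < b then 0 else 1)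
        = if (k : ℕ) < b - 1 then 0 else 1 := by
      intro k
      rw [skipIdx_val, hi]
      split_ifs <;> omega
    rw [Finset.sum_congr rfl fun k _ => hterm k,
      Fin.sum_univ_eq_sum_range fun k => if k < b - 1 then 0 else 1,
      show m*b - 1 = (b - 1) + (m*b - b) by omega, Finset.sum_range_add,
      Finset.sum_eq_zero fun k hk => if_pos (Finset.mem_range.mp hk)]
    simp
  rw [← hdeg]
  exact isHomogeneous_det_of_rows fun k l => QP_isHomogeneous m b hm hb c _ _

/-- Specialising `X (t, s)` to `1` for `s ∈ {t b + b - 1, t b + b}` and to `0` otherwise turns the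
symbolic rows into the equations `y p + y (p + 1) = 0`. -/
def bidiagonalPoint (m b : ℕ) : Fin (m - 1) × ℕ → ZMod 2 :=
  fun x => if x.2 = x.1 * b + b - 1 ∨ x.2 = x.1 * b + b then 1 else 0

theorem minor_row_b_sub_one_ne_zero (m b : ℕ) (hm : 2 ≤ m) (hb : 1 ≤ b)
    (c : Fin (m*b) → ZMod 2) (i j : Fin (m*b)) (hi : (i : ℕ) = b - 1)
    (hj : (j : ℕ) < m*b - b) :
    minorQ (QP m b hm hb c) i j ≠ 0 := by
  have h2 := Nat.mul_le_mul hm (le_refl b)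
  refine fun h0 => ?_
  have hmap := map_minorQ (eval (bidiagonalPoint m b)) (QP m b hm hb c) i j
  rw [h0, map_zero] at hmap
  refine minorQ_ne_zero_of_forall _ i j (fun y hyj hrow => ?_) hmap.symm
  simp only [map_apply] at hrow
  have hlast : ∀ q, q < b - 1 → ∀ k : Fin (m*b), (k : ℕ) = m*b - 1 - q → y k = 0 := by
    intro q
    induction q using Nat.strong_induction_on with
    | _ q ih =>
      intro hq k hk
      have hr := hrow ⟨q, by omega⟩ (fun e => by
        have := congrArg Fin.val e
        simp only at this
        omega)
      rw [Finset.sum_eq_single k] at hr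
      · simp only [QP] at hr
        rwa [if_pos (by omega), uSeq_of_lt c (by omega), if_pos (by omega), eval_C, one_mul] at hr
      · intro l _ hlk
        have hlk' : (l : ℕ) ≠ k := fun e => hlk (Fin.ext e)
        have hl := l.isLt
        rcases lt_or_gt_of_ne hlk' with hlt | hgt
        · simp only [QP]
          rw [if_pos (by omega), uSeq_of_lt c (by omega), if_neg (by omega), eval_C, zero_mul]
        · rw [ih (m*b - 1 - l) (by omega) (by omega) l (by omega), mul_zero]
      · simp
  have hbig : ∀ k : Fin (m*b), m*b - b < (k : ℕ) → y k = 0 := by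
    intro k hk
    have hk' := k.isLt
    exact hlast (m*b - 1 - k) (by omega) k (by omega)
  have hstep : ∀ p (hp : p < m*b - b),
      y ⟨p, by omega⟩ = y ⟨p + 1, by omega⟩ := by
    intro p hp
    have hdm := Nat.div_add_mod' p b
    have hmod := Nat.mod_lt p (show 0 < b by omega)
    have ht : p / b < m - 1 :=
      Nat.div_lt_of_lt_mul (by rwa [Nat.mul_sub, mul_one, Nat.mul_comm b m])
    have hblock : p / b * b + b ≤ m*b - b := by
      have := Nat.mul_le_mul_right b (show p / b + 1 ≤ m - 1 from ht)
      rwa [Nat.add_mul, one_mul, Nat.sub_mul, one_mul] at this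
    generalize hT : p / b = T at *
    generalize hS : p % b = S at *
    have hidx : b + T * b + (b - 1 - S) - b = (b - 1 - S) + b * T := by
      rw [Nat.mul_comm b T]; omega
    have hr := hrow ⟨b + T * b + (b - 1 - S), by omega⟩ (fun e => by
        have := congrArg Fin.val e
        simp only at this
        omega)
    have hentry : ∀ k : Fin (m*b), (k : ℕ) ≤ m*b - b →
        eval (bidiagonalPoint m b) (QP m b hm hb c ⟨b + T * b + (b - 1 - S), by omega⟩ k)
          = if (k : ℕ) = p ∨ (k : ℕ) = p + 1 then 1 else 0 := by
      intro k hk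
      have hdiv : (b + T * b + (b - 1 - S) - b) / b = T := by
        rw [hidx, Nat.add_mul_div_left _ _ (by omega), Nat.div_eq_of_lt (by omega), zero_add]
      have hmd : (b + T * b + (b - 1 - S) - b) % b = b - 1 - S := by
        rw [hidx, Nat.add_mul_mod_self_left, Nat.mod_eq_of_lt (by omega)]
      simp only [QP]
      rw [if_neg (by omega), wPoly_of_lt c _ (by omega), eval_X]
      simp only [bidiagonalPoint, hdiv, hmd]
      exact if_congr (by omega) rfl rfl
    rw [Fintype.sum_eq_add (⟨p, by omega⟩ : Fin (m*b)) ⟨p + 1, by omega⟩ (by simp)] at hr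
    · rw [hentry _ (by simp only; omega), hentry _ (by simp only; omega), if_pos (Or.inl rfl),
        if_pos (Or.inr rfl), one_mul, one_mul] at hr
      exact CharTwo.add_eq_zero.mp hr
    · rintro k ⟨hk1, hk2⟩
      by_cases hk : (k : ℕ) ≤ m*b - b
      · rw [hentry k hk, if_neg, zero_mul]
        rintro (e | e)
        · exact hk1 (Fin.ext e)
        · exact hk2 (Fin.ext e)
      · rw [hbig k (by omega), mul_zero]
  have hconst : ∀ p (hp : p ≤ m*b - b), y ⟨p, by omega⟩ = y ⟨0, by omega⟩ := by
    intro p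
    induction p with
    | zero => intro _; rfl
    | succ p ih => intro hp; rw [← hstep p (by omega), ih (by omega)]
  funext k
  by_cases hk : (k : ℕ) ≤ m*b - b
  · exact ((hconst k hk).trans (hconst j hj.le).symm).trans hyj
  · exact hbig k (by omega)

/-- For every column index `j < n - b`, the minor `μ(b-1, j)` of `Q_P`
has total degree exactly `n - b`. -/
theorem minor_row_b_sub_one_totalDegree
    (m b : ℕ) (hm : 2 ≤ m) (hb : 1 ≤ b) (c : Fin (m*b) → ZMod 2)
    (j : Fin (m*b)) (hj : (j : ℕ) < m*b - b) :
    (minorQ (QP m b hm hb c)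
        ⟨b - 1, by have := Nat.mul_le_mul hm (le_refl b); omega⟩ j).totalDegree
      = m*b - b := by
  exact (minor_row_b_sub_one_isHomogeneous m b hm hb c _ j rfl).totalDegree
    (minor_row_b_sub_one_ne_zero m b hm hb c _ j rfl hj)
end

section
/- For all indices i, j with i < b and i + j > n − 1 (i.e., (i,j) lies strictly below the anti-diagonal of the top-right block of Q_P), the minor μ(i, j) of Q_P equals 0. -/
open MvPolynomial Matrix

/-- A square matrix with a zero block whose numbers of rows and columns add up to more than the
size of the matrix has determinant zero. -/
theorem Matrix.det_eq_zero_of_zero_block {ι R : Type*} [Fintype ι] [DecidableEq ι] [CommRing R]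
    (M : Matrix ι ι R) (s t : Finset ι) (hst : Fintype.card ι < s.card + t.card)
    (h : ∀ i ∈ s, ∀ j ∈ t, M i j = 0) : M.det = 0 := by
  rw [Matrix.det_apply]
  refine Finset.sum_eq_zero fun σ _ => ?_
  obtain ⟨k, hkt, hks⟩ : ∃ k ∈ t, σ k ∈ s := by
    by_contra! hcon
    have hdisj : Disjoint s (t.map σ.toEmbedding) := by
      rw [Finset.disjoint_right]
      intro x hx
      obtain ⟨k, hk, rfl⟩ := Finset.mem_map.mp hx
      exact hcon k hk
    have hcard := Finset.card_le_univ (s.disjUnion _ hdisj)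
    rw [Finset.card_disjUnion, Finset.card_map] at hcard
    omega
  rw [Finset.prod_eq_zero (f := fun i => M (σ i) i)
    (Finset.mem_univ k) (h _ hks _ hkt), smul_zero]

theorem uSeq_eq_zero_of_lt (m b : ℕ) (c : Fin (m*b) → ZMod 2) {s : ℕ} (hs : s < m*b - 1) :
    uSeq m b c s = 0 := by
  rw [uSeq, if_pos (by omega), if_neg (by omega)]

theorem val_skipIdx_of_lt {n : ℕ} {i : Fin n} {k : Fin (n - 1)} (h : (k : ℕ) < i) :
    (skipIdx i k : ℕ) = k := by
  simp [skipIdx, h]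

/-- For `i < b` with `i + j > n - 1` (strictly below the anti-diagonal of the
top-right block), the minor `μ(i,j)` of `Q_P` equals `0`. -/
theorem minor_below_antidiagonal_eq_zero
    (m b : ℕ) (hm : 2 ≤ m) (hb : 1 ≤ b) (c : Fin (m*b) → ZMod 2)
    (i j : Fin (m*b)) (hi : (i : ℕ) < b) (hij : m*b - 1 < (i : ℕ) + (j : ℕ)) :
    minorQ (QP m b hm hb c) i j = 0 := by
  have hj := j.isLt
  refine Matrix.det_eq_zero_of_zero_block _
    (Finset.univ.filter fun k => (k : ℕ) < i) (Finset.univ.filter fun l => (l : ℕ) < m*b - i)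
    ?_ fun k hk l hl => ?_
  · rw [Fin.card_filter_val_lt, Fin.card_filter_val_lt, Fintype.card_fin]
    omega
  · simp only [Finset.mem_filter, Finset.mem_univ, true_and] at hk hl
    have hrow := val_skipIdx_of_lt hk
    have hcol := val_skipIdx_of_lt (i := j) (k := l) (by omega)
    rw [Matrix.submatrix_apply, QP, if_pos (by omega), hrow, hcol,
      uSeq_eq_zero_of_lt m b c (by omega), map_zero]
end

section
/- Every entry of the adjugate matrix of Q_P has total degree at most n − b. -/
open MvPolynomial Matrix

/-- The total degree of a determinant is bounded by the sum of bounds on the degrees of the rows. -/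
theorem totalDegree_det_le_sum {ι σ R : Type*} [Fintype ι] [DecidableEq ι] [CommRing R]
    (A : Matrix ι ι (MvPolynomial σ R)) (d : ι → ℕ)
    (hA : ∀ i j, (A i j).totalDegree ≤ d i) :
    A.det.totalDegree ≤ ∑ i, d i := by
  rw [Matrix.det_apply]
  refine totalDegree_finsetSum_le fun τ _ => ?_
  calc (Equiv.Perm.sign τ • ∏ i, A (τ i) i).totalDegree
      ≤ (∏ i, A (τ i) i).totalDegree := by
        rcases Int.units_eq_one_or (Equiv.Perm.sign τ) with h | h <;>
          simp [h, Units.neg_smul, totalDegree_neg]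
    _ ≤ ∑ i, (A (τ i) i).totalDegree := totalDegree_finsetProd _ _
    _ ≤ ∑ i, d (τ i) := Finset.sum_le_sum fun i _ => hA _ _
    _ = ∑ i, d i := Equiv.sum_comp τ d

/-- Every term of the symbolic sequence is a polynomial of degree at most one. -/
theorem totalDegree_wPoly_le_one (m b : ℕ) (c : Fin (m*b) → ZMod 2) (t : Fin (m-1)) (s : ℕ) :
    (wPoly m b c t s).totalDegree ≤ 1 := by
  induction s using Nat.strong_induction_on with
  | _ s ih =>
    rw [wPoly]
    split_ifs with h
    · exact (totalDegree_X _).le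
    · refine totalDegree_finsetSum_le fun j _ => (totalDegree_mul _ _).trans ?_
      rw [totalDegree_C, zero_add]
      exact ih _ (by have := j.isLt; omega)

/-- The entries of `QP` are constant in the first `b` rows and of degree at most one elsewhere. -/
theorem totalDegree_QP_le (m b : ℕ) (hm : 2 ≤ m) (hb : 1 ≤ b) (c : Fin (m*b) → ZMod 2)
    (i j : Fin (m*b)) :
    (QP m b hm hb c i j).totalDegree ≤ if (i : ℕ) < b then 0 else 1 := by
  unfold QP
  split_ifs
  · exact (totalDegree_C _).le
  · exact totalDegree_wPoly_le_one ..

/-- Every entry of the adjugate matrix of `Q_P` has total degree at most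
`n - b`. -/
theorem adjugate_QP_totalDegree_le
    (m b : ℕ) (hm : 2 ≤ m) (hb : 1 ≤ b) (c : Fin (m*b) → ZMod 2)
    (i j : Fin (m*b)) :
    ((QP m b hm hb c).adjugate i j).totalDegree ≤ m*b - b := by
  rw [Matrix.adjugate_apply]
  refine (totalDegree_det_le_sum _ (fun k : Fin (m*b) => if (k : ℕ) < b then 0 else 1)
    fun k l => ?_).trans_eq ?_
  · rcases eq_or_ne k j with rfl | hk
    · rw [Matrix.updateRow_self, Pi.single_apply]
      split_ifs <;> simp
    · rw [Matrix.updateRow_ne hk]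
      exact totalDegree_QP_le m b hm hb c k l
  · have hbn : b ≤ m * b := Nat.le_mul_of_pos_left b (by omega)
    rw [Fin.sum_univ_eq_sum_range (fun k => if k < b then 0 else 1), Finset.sum_ite,
      Finset.sum_const_zero, zero_add, Finset.sum_const, smul_eq_mul, mul_one,
      show (Finset.range (m * b)).filter (fun k => ¬ k < b) = Finset.Ico b (m * b) by
        ext k; simp [and_comm], Nat.card_Ico]
end

section
/- The determinant of Q_P equals the determinant of its bottom-left block Q₃, i.e., det Q_P = det Q₃ (in particular, the top-left b×(n−b) block of Q_P is zero and the top-right b×b block is anti-triangular with ones on the anti-diagonal, so its determinant contributes a factor 1 in characteristic 2). -/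
open MvPolynomial Matrix

/-- In characteristic two, permuting rows and columns independently preserves the determinant. -/
theorem Matrix.det_submatrix_equiv_equiv_of_charTwo {ι κ R : Type*} [Fintype ι] [DecidableEq ι]
    [Fintype κ] [DecidableEq κ] [CommRing R] [CharP R 2] (e f : ι ≃ κ) (M : Matrix κ κ R) :
    (M.submatrix e f).det = M.det := by
  have hM : M.submatrix e f = (M.submatrix e e).submatrix id (f.trans e.symm) := by
    ext i j
    simp
  rw [hM, Matrix.det_permute', Matrix.det_submatrix_equiv_self]
  rcases Int.units_eq_one_or (Equiv.Perm.sign (f.trans e.symm)) with h | h <;>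
    simp [h, CharTwo.neg_eq]

theorem uSeq_eq_zero (m b : ℕ) (c : Fin (m*b) → ZMod 2) {s : ℕ} (hs : s + 1 < m*b) :
    uSeq m b c s = 0 := by
  rw [uSeq, if_pos (by omega), if_neg (by omega)]

theorem uSeq_eq_one (m b : ℕ) (c : Fin (m*b) → ZMod 2) {s : ℕ} (hs : s + 1 = m*b) :
    uSeq m b c s = 1 := by
  rw [uSeq, if_pos (by omega), if_pos (by omega)]

/-- `det Q_P = det Q₃`. -/
theorem det_QP_eq_det_Q3
    (m b : ℕ) (hm : 2 ≤ m) (hb : 1 ≤ b) (c : Fin (m*b) → ZMod 2) :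
    (QP m b hm hb c).det = (Q3 m b hm hb c).det := by
  have hbn : b ≤ m * b := Nat.le_mul_of_pos_left b (by omega)
  have hn : b + (m*b - b) = m*b := by omega
  -- Reverse the first `b` rows and move the last `b` columns to the front.
  let e : Fin b ⊕ Fin (m*b - b) ≃ Fin (m*b) :=
    ((Equiv.sumCongr Fin.revPerm (Equiv.refl _)).trans finSumFinEquiv).trans (finCongr hn)
  let f : Fin b ⊕ Fin (m*b - b) ≃ Fin (m*b) :=
    ((Equiv.sumComm _ _).trans finSumFinEquiv).trans (finCongr (by omega))
  have heInl (i : Fin b) : (e (Sum.inl i) : ℕ) = b - 1 - i := by simp [e, Fin.val_rev]; omega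
  have heInr (i : Fin (m*b - b)) : (e (Sum.inr i) : ℕ) = b + i := by simp [e]
  have hfInl (j : Fin b) : (f (Sum.inl j) : ℕ) = m*b - b + j := by simp [f]
  have hfInr (j : Fin (m*b - b)) : (f (Sum.inr j) : ℕ) = j := by simp [f]
  have hTop (i : Fin b) (x) : QP m b hm hb c (e (Sum.inl i)) x
      = C (uSeq m b c (b - 1 - i + x)) := by
    have := heInl i
    rw [QP, if_pos (by omega), heInl]
  set A := (QP m b hm hb c).submatrix e f with hA
  have hZero : A.toBlocks₁₂ = 0 := by
    ext1 i j
    change QP m b hm hb c (e (Sum.inl i)) (f (Sum.inr j)) = 0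
    rw [hTop, hfInr, uSeq_eq_zero _ _ _ (by omega), C_0]
  have hTri : A.toBlocks₁₁.IsUpperTriangular := by
    intro i j hij
    change QP m b hm hb c (e (Sum.inl i)) (f (Sum.inl j)) = 0
    have : (j : ℕ) < i := hij
    rw [hTop, hfInl, uSeq_eq_zero _ _ _ (by omega), C_0]
  have hDiag (i : Fin b) : A.toBlocks₁₁ i i = 1 := by
    change QP m b hm hb c (e (Sum.inl i)) (f (Sum.inl i)) = 1
    rw [hTop, hfInl, uSeq_eq_one _ _ _ (by omega), C_1]
  have hBot : A.toBlocks₂₂ = Q3 m b hm hb c := by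
    ext1 i j
    exact congrArg₂ (QP m b hm hb c) (Fin.ext (heInr i)) (Fin.ext (hfInr j))
  rw [← Matrix.det_submatrix_equiv_equiv_of_charTwo e f, ← hA, ← fromBlocks_toBlocks A, hZero,
    det_fromBlocks_zero₁₂, hBot, det_of_isUpperTriangular hTri, Finset.prod_congr rfl
    (fun i _ => hDiag i), Finset.prod_const_one, one_mul]
end

section
/- The determinant of the bottom-left block Q₃ of Q_P is a polynomial of total degree exactly n − b; in particular, the product of the diagonal entries of Q₃ (which are pairwise distinct indeterminates) occurs as a monomial of det Q₃ that is produced by the identity permutation alone. -/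
open MvPolynomial Matrix

/-- The Leibniz expansion of the determinant of a matrix of indeterminates. -/
lemma det_of_X_eq_sum_monomial {ι σ R : Type*} [Fintype ι] [DecidableEq ι] [CommRing R]
    (f : ι → ι → σ) :
    (Matrix.of fun i j => (X (f i j) : MvPolynomial σ R)).det =
      ∑ p : Equiv.Perm ι, monomial (∑ i, Finsupp.single (f (p i) i) 1)
        ((Equiv.Perm.sign p : ℤ) : R) := by
  rw [Matrix.det_apply']
  refine Finset.sum_congr rfl fun p _ => ?_
  simp only [Matrix.of_apply, X]
  rw [← monomial_sum_one, ← map_intCast (C : R →+* MvPolynomial σ R), C_mul_monomial, mul_one]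

lemma isHomogeneous_det_of_X {ι σ R : Type*} [Fintype ι] [DecidableEq ι] [CommRing R]
    (f : ι → ι → σ) :
    (Matrix.of fun i j => (X (f i j) : MvPolynomial σ R)).det.IsHomogeneous (Fintype.card ι) := by
  rw [det_of_X_eq_sum_monomial]
  refine IsHomogeneous.sum _ _ _ fun p _ => isHomogeneous_monomial _ ?_
  simp [map_sum]

lemma coeff_diag_det_of_X {ι σ R : Type*} [Fintype ι] [DecidableEq ι] [CommRing R]
    (f : ι → ι → σ)
    (hf : ∀ p : Equiv.Perm ι, ∑ i, Finsupp.single (f (p i) i) 1 =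
      (∑ i, Finsupp.single (f i i) 1 : σ →₀ ℕ) → p = 1) :
    coeff (∑ i, Finsupp.single (f i i) 1)
      (Matrix.of fun i j => (X (f i j) : MvPolynomial σ R)).det = 1 := by
  classical
  rw [det_of_X_eq_sum_monomial, coeff_sum, Finset.sum_eq_single 1]
  · simp
  · intro p _ hp
    rw [coeff_monomial, if_neg fun h => hp (hf p h)]
  · simp

/-- A permutation with `∑ (p i + i)² = ∑ (2 i)²` is the identity. -/
lemma perm_eq_one_of_sum_add_sq {N : ℕ} (p : Equiv.Perm (Fin N))
    (h : ∑ i, ((p i : ℕ) + (i : ℕ)) ^ 2 = ∑ i : Fin N, ((i : ℕ) + (i : ℕ)) ^ 2) : p = 1 := by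
  have hz : ∑ i, (((p i : ℕ) : ℤ) + (i : ℕ)) ^ 2 =
      ∑ i : Fin N, (((i : ℕ) : ℤ) + (i : ℕ)) ^ 2 := by exact_mod_cast h
  have hp : ∑ i, (((p i : ℕ) : ℤ)) ^ 2 = ∑ i : Fin N, ((i : ℕ) : ℤ) ^ 2 :=
    Equiv.sum_comp p fun i : Fin N => ((i : ℕ) : ℤ) ^ 2
  have hd : ∑ i, (((p i : ℕ) : ℤ) - (i : ℕ)) ^ 2 = 0 := by
    have e : ∀ i, (((p i : ℕ) : ℤ) - (i : ℕ)) ^ 2 =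
        2 * ((p i : ℕ) : ℤ) ^ 2 + 2 * ((i : ℕ) : ℤ) ^ 2 - (((p i : ℕ) : ℤ) + (i : ℕ)) ^ 2 :=
      fun i => by ring
    have e' : ∀ i : Fin N, (((i : ℕ) : ℤ) + (i : ℕ)) ^ 2 = 4 * ((i : ℕ) : ℤ) ^ 2 :=
      fun i => by ring
    simp only [e', ← Finset.mul_sum] at hz
    simp only [e, Finset.sum_sub_distrib, Finset.sum_add_distrib, ← Finset.mul_sum]
    linarith
  rw [Finset.sum_eq_zero_iff_of_nonneg fun i _ => sq_nonneg _] at hd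
  ext i
  have := pow_eq_zero_iff two_ne_zero |>.mp (hd i (Finset.mem_univ i))
  simp only [Equiv.Perm.coe_one, id_eq]
  omega

lemma div_lt_pred_of_lt {m b i : ℕ} (hi : i < m * b - b) : i / b < m - 1 :=
  Nat.div_lt_of_lt_mul (by rwa [Nat.mul_sub_one, Nat.mul_comm b m])

/-- The index of the indeterminate at position `(i, j)` of `Q₃`. -/
def Q3Index (m b : ℕ) (i j : Fin (m * b - b)) : Fin (m - 1) × ℕ :=
  (⟨(i : ℕ) / b, div_lt_pred_of_lt i.isLt⟩, (i : ℕ) % b + j)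

lemma Q3_eq_of_X (m b : ℕ) (hm : 2 ≤ m) (hb : 1 ≤ b) (c : Fin (m * b) → ZMod 2) :
    Q3 m b hm hb c = Matrix.of fun i j => X (Q3Index m b i j) := by
  ext1 i j
  have hlt : (i : ℕ) % b + j < m * b := by
    have := Nat.mod_lt (i : ℕ) hb
    omega
  simp only [Q3, QP, Matrix.of_apply, Q3Index]
  rw [if_neg (by omega), wPoly, if_pos (by simpa using hlt)]
  simp

/-- Adding `b` times the first component of the index to the second one yields `i + j`. -/
lemma Q3Index_snd_add (m b : ℕ) (i j : Fin (m * b - b)) :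
    (Q3Index m b i j).2 + b * (Q3Index m b i j).1 = i + j := by
  have := Nat.mod_add_div (i : ℕ) b
  simp only [Q3Index]
  omega

lemma Q3Index_diag_injective (m b : ℕ) : Function.Injective fun i => Q3Index m b i i := by
  intro i j h
  have hi := Q3Index_snd_add m b i i
  have hj := Q3Index_snd_add m b j j
  simp only at h
  rw [h] at hi
  ext
  omega

/-- Only the identity permutation produces the diagonal monomial of `Q₃`. -/
lemma perm_eq_one_of_Q3Index_monomial_eq (m b : ℕ) (p : Equiv.Perm (Fin (m * b - b)))
    (h : ∑ i, Finsupp.single (Q3Index m b (p i) i) 1 =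
      (∑ i, Finsupp.single (Q3Index m b i i) 1 : Fin (m - 1) × ℕ →₀ ℕ)) : p = 1 := by
  apply perm_eq_one_of_sum_add_sq
  have := congrArg (Finsupp.weight fun x : Fin (m - 1) × ℕ => (x.2 + b * x.1) ^ 2) h
  simpa [map_sum, Finsupp.weight_single, Q3Index_snd_add] using this

/-- `det Q₃` has total degree exactly `n - b`; moreover the diagonal entries of
`Q₃` are pairwise distinct indeterminates, their product is a monomial (the contribution of
the identity permutation alone), and this monomial occurs in `det Q₃` (with coefficient 1). -/
theorem det_Q3_totalDegree
    (m b : ℕ) (hm : 2 ≤ m) (hb : 1 ≤ b) (c : Fin (m*b) → ZMod 2) :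
    ((Q3 m b hm hb c).det).totalDegree = m*b - b ∧
    ∃ v : Fin (m*b - b) → (Fin (m-1)) × ℕ,
      Function.Injective v ∧
      (∀ i, Q3 m b hm hb c i i = X (v i)) ∧
      (∏ i, Q3 m b hm hb c i i)
        = MvPolynomial.monomial (∑ i, Finsupp.single (v i) 1) 1 ∧
      MvPolynomial.coeff (∑ i, Finsupp.single (v i) 1) (Q3 m b hm hb c).det = 1 := by
  have hcoeff := coeff_diag_det_of_X (R := ZMod 2) (Q3Index m b)
    (perm_eq_one_of_Q3Index_monomial_eq m b)
  rw [Q3_eq_of_X]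
  refine ⟨?_, fun i => Q3Index m b i i, Q3Index_diag_injective m b, fun i => rfl, ?_, hcoeff⟩
  · refine (isHomogeneous_det_of_X _).totalDegree ?_ |>.trans (Fintype.card_fin _)
    intro h
    simp [h] at hcoeff
  · exact (monomial_sum_one _ _).symm
end

section
/- Let N be the number of n×n matrices over F₂ = ZMod 2 in M-companion form whose characteristic polynomial is primitive. Then N · n · (2^m − 1) = (∏_{i=0}^{m−1} (2^m − 2^i)) · φ(2^n − 1) · 2^{m(m−1)(b−1)}, where φ is Euler's totient function and ∏_{i=0}^{m−1} (2^m − 2^i) is the order of the general linear group GL(m, F₂). Equivalently, N = (|GL(m,F₂)| / (2^m − 1)) · (φ(2^n − 1) / n) · 2^{m(m−1)(b−1)}. -/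
open Matrix

/-- A matrix over `ZMod 2`, indexed blockwise by `Fin b × Fin m`, is in M-companion form if
every block-row `i` with `i < b - 1` consists of the `m × m` identity block in block-column
`i + 1` and zero blocks elsewhere (the last block-row is arbitrary). -/
def MCompanionForm (m b : ℕ)
    (Cm : Matrix (Fin b × Fin m) (Fin b × Fin m) (ZMod 2)) : Prop :=
  ∀ i : Fin b, (i : ℕ) < b - 1 → ∀ k : Fin m, ∀ j : Fin b, ∀ l : Fin m,
    Cm (i, k) (j, l) = if (j : ℕ) = (i : ℕ) + 1 ∧ k = l then 1 else 0

/-- A monic polynomial of degree `n` over `ZMod 2` is primitive if it is irreducible and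
the image of `X` in the quotient field `AdjoinRoot p` has multiplicative order `2^n - 1`. -/
def IsPrimitivePoly (n : ℕ) (p : Polynomial (ZMod 2)) : Prop :=
  p.Monic ∧ p.natDegree = n ∧ Irreducible p ∧
    orderOf (AdjoinRoot.root p) = 2 ^ n - 1

theorem Nat.card_mul_eq_card_mul_of_forall {α β : Type*} [Finite α] [Finite β] (r : α → β → Prop)
    {m n : ℕ} (hm : ∀ a, Nat.card {b // r a b} = m) (hn : ∀ b, Nat.card {a // r a b} = n) :
    Nat.card α * m = Nat.card β * n := by
  have := Fintype.ofFinite α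
  have := Fintype.ofFinite β
  have e : (Σ a, {b // r a b}) ≃ (Σ b, {a // r a b}) :=
    ⟨fun p => ⟨p.2.1, p.1, p.2.2⟩, fun p => ⟨p.2.1, p.1, p.2.2⟩, fun _ => rfl, fun _ => rfl⟩
  have h := Nat.card_congr e
  simpa [Nat.card_sigma, hm, hn] using h

section NoInvariant

variable {K V : Type*} [Field K] [AddCommGroup V] [Module K V]

/-- The subspace `U` contains no nonzero `T`-invariant subspace. -/
def NoInvariant (T : V →ₗ[K] V) (U : Submodule K V) : Prop :=
  ∀ W ≤ U, W ≤ W.comap T → W = ⊥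

theorem NoInvariant.mono {T : V →ₗ[K] V} {U U' : Submodule K V} (h : NoInvariant T U')
    (hU : U ≤ U') : NoInvariant T U :=
  fun W hW => h W (hW.trans hU)

theorem NoInvariant.congr {T T' : V →ₗ[K] V} {U : Submodule K V} (h : NoInvariant T U)
    (hT : ∀ u ∈ U, T' u = T u) : NoInvariant T' U :=
  fun W hW hWT => h W hW fun w hw => by
    have := hWT hw
    rwa [Submodule.mem_comap, hT w (hW hw)] at this

theorem card_eq_card_mul_card_inf_ker (ξ : V →ₗ[K] K) {U : Submodule K V} {v : V}
    (hv : v ∈ U) (hξ : ξ v = 1) :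
    Nat.card U = Nat.card K * Nat.card (U ⊓ LinearMap.ker ξ : Submodule K V) := by
  rw [← Nat.card_prod]
  refine Nat.card_congr
    { toFun := fun u => (ξ u, ⟨u - ξ u • v, U.sub_mem u.2 (U.smul_mem _ hv), by simp [hξ]⟩)
      invFun := fun p => ⟨p.2 + p.1 • v, U.add_mem p.2.2.1 (U.smul_mem _ hv)⟩
      left_inv := fun u => by simp
      right_inv := fun p => ?_ }
  have : ξ p.2 = 0 := p.2.2.2
  ext <;> simp [hξ, this]

theorem card_inf_ker_eq_card_fiber (ξ : V →ₗ[K] K) {U : Submodule K V} {v : V}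
    (hv : v ∈ U) (hξ : ξ v = 1) :
    Nat.card {w // w ∈ U ∧ ξ w = 1} = Nat.card (U ⊓ LinearMap.ker ξ : Submodule K V) :=
  Nat.card_congr
    { toFun := fun w => ⟨w - v, U.sub_mem w.2.1 hv, by simp [hξ, w.2.2]⟩
      invFun := fun u => ⟨u + v, U.add_mem u.2.1 hv, by
        have : ξ u = 0 := u.2.2
        simp [hξ, this]⟩
      left_inv := fun u => by simp
      right_inv := fun u => by simp }

/-- A nonzero invariant subspace of `U` meets the affine hyperplane `ξ = 1`, provided
`U ⊓ ker ξ` contains no nonzero invariant subspace. -/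
theorem exists_mem_eq_one {T : V →ₗ[K] V} {ξ : V →ₗ[K] K} {U : Submodule K V}
    (h : NoInvariant T (U ⊓ LinearMap.ker ξ)) (x : V) {W : Submodule K V} (hWU : W ≤ U)
    (hW : W ≤ W.comap (T + ξ.smulRight x)) (hW0 : W ≠ ⊥) : ∃ w ∈ W, ξ w = 1 := by
  by_contra! hc
  have hker : W ≤ LinearMap.ker ξ := fun w hw => by
    by_contra h0
    rw [LinearMap.mem_ker] at h0
    exact hc ((ξ w)⁻¹ • w) (W.smul_mem _ hw) (by simp [h0])
  refine hW0 (h W (le_inf hWU hker) fun w hw => ?_)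
  have h1 : ξ w = 0 := hker hw
  simpa [h1] using hW hw

variable [Finite V]

/-- If `U ⊓ ker ξ` contains no nonzero `T`-invariant subspace, then the number of rank one updates
`T + ξ ⊗ x` that leave some nonzero subspace of `U` invariant is the cardinality of `U`. -/
theorem card_not_noInvariant_update (T : V →ₗ[K] V) (ξ : V →ₗ[K] K) (U : Submodule K V)
    (hξ : ∃ v ∈ U, ξ v = 1) (h : NoInvariant T (U ⊓ LinearMap.ker ξ)) :
    Nat.card {x // ¬ NoInvariant (T + ξ.smulRight x) U} = Nat.card U := by
  induction hn : Nat.card U using Nat.strong_induction_on generalizing U with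
  | _ n ih =>
  subst hn
  obtain ⟨v, hv, hξv⟩ := hξ
  by_cases hT : ∀ u ∈ U, ξ u = 0 → T u ∈ U
  · have key : ∀ x, ¬ NoInvariant (T + ξ.smulRight x) U ↔ T v + x ∈ U := by
      intro x
      constructor
      · intro hx
        simp only [NoInvariant, not_forall] at hx
        obtain ⟨W, hWU, hW, hW0⟩ := hx
        obtain ⟨w, hw, hw1⟩ := exists_mem_eq_one h x hWU hW hW0
        have h1 : T (v - w) ∈ U := hT _ (U.sub_mem hv (hWU hw)) (by simp [hξv, hw1])
        have h2 : T w + x ∈ U := by simpa [hw1] using hWU (hW hw)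
        convert U.add_mem h1 h2 using 1
        rw [map_sub]
        abel
      · intro hx hN
        have hU : U = ⊥ := hN U le_rfl fun u hu => by
          have h1 : T (u - ξ u • v) ∈ U :=
            hT _ (U.sub_mem hu (U.smul_mem _ hv)) (by simp [hξv])
          rw [Submodule.mem_comap]
          convert U.add_mem h1 (U.smul_mem (ξ u) hx) using 1
          simp only [LinearMap.add_apply, LinearMap.smulRight_apply, map_sub, map_smul, smul_add]
          abel
        rw [hU, Submodule.mem_bot] at hv
        simp [hv] at hξv
    simp_rw [key]
    exact Nat.card_congr
      { toFun := fun x => ⟨T v + x, x.2⟩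
        invFun := fun u => ⟨u - T v, by simp⟩
        left_inv := fun x => by simp
        right_inv := fun x => by simp }
  · push Not at hT
    obtain ⟨u₀, hu₀, hξu₀, hTu₀⟩ := hT
    -- the subspace of those `u ∈ U` that are mapped into `U` by the updates mapping `w` into `U`
    let U₁ : V → Submodule K V := fun w => U ⊓ U.comap (T ∘ₗ (LinearMap.id - ξ.smulRight w))
    have hmem : ∀ w u, u ∈ U₁ w ↔ u ∈ U ∧ T u - ξ u • T w ∈ U := fun w u => by simp [U₁]
    let U₀ : Submodule K V := U ⊓ LinearMap.ker ξ ⊓ U.comap T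
    have hU₀ : ∀ w, U₁ w ⊓ LinearMap.ker ξ = U₀ := fun w => by
      ext u
      simp only [Submodule.mem_inf, hmem, LinearMap.mem_ker, U₀, Submodule.mem_comap]
      constructor
      · rintro ⟨⟨h1, h2⟩, h3⟩
        exact ⟨⟨h1, h3⟩, by simpa [h3] using h2⟩
      · rintro ⟨⟨h1, h3⟩, h2⟩
        exact ⟨⟨h1, by simpa [h3] using h2⟩, h3⟩
    have hlt : ∀ w, Nat.card (U₁ w) < Nat.card U := fun w => by
      refine Set.ncard_lt_ncard (s := (U₁ w : Set V)) (t := U) ?_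
      refine ⟨fun u hu => hu.1, fun hle => hTu₀ ?_⟩
      have := ((hmem w u₀).1 (hle hu₀)).2
      simpa [hξu₀] using this
    have hiff : ∀ w ∈ U, ξ w = 1 → ∀ x, (¬ NoInvariant (T + ξ.smulRight x) U ∧ T w + x ∈ U) ↔
        ¬ NoInvariant (T + ξ.smulRight x) (U₁ w) := by
      intro w hw hξw x
      constructor
      · rintro ⟨hx, hwx⟩ hN
        refine hx fun W hWU hW => hN W (fun u hu => (hmem w u).2 ⟨hWU hu, ?_⟩) hW
        have h1 : T u + ξ u • x ∈ U := by simpa using hWU (hW hu)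
        have := U.sub_mem h1 (U.smul_mem (ξ u) hwx)
        rwa [smul_add, add_sub_add_right_eq_sub] at this
      · intro hx
        refine ⟨fun hN => hx (hN.mono inf_le_left), ?_⟩
        simp only [NoInvariant, not_forall] at hx
        obtain ⟨W, hWU, hW, hW0⟩ := hx
        obtain ⟨y, hy, hy1⟩ := exists_mem_eq_one h x (hWU.trans inf_le_left) hW hW0
        have h1 := ((hmem w y).1 (hWU hy)).2
        have h2 : T y + x ∈ U := by simpa [hy1] using (hWU (hW hy)).1
        convert U.sub_mem h2 h1 using 1
        rw [hy1, one_smul]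
        abel
    have hcount := Nat.card_mul_eq_card_mul_of_forall
      (fun (w : {w // w ∈ U ∧ ξ w = 1}) (x : {x // ¬ NoInvariant (T + ξ.smulRight x) U}) =>
        T w.1 + x.1 ∈ U) (m := Nat.card K * Nat.card U₀) (n := Nat.card U₀) ?_ ?_
    · rw [card_inf_ker_eq_card_fiber ξ hv hξv, ← mul_assoc] at hcount
      rw [card_eq_card_mul_card_inf_ker ξ hv hξv, mul_comm (Nat.card K)]
      exact (Nat.eq_of_mul_eq_mul_right Nat.card_pos hcount).symm
    · rintro ⟨w, hw, hξw⟩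
      have hw₁ : w ∈ U₁ w := (hmem w w).2 ⟨hw, by simp [hξw]⟩
      rw [← hU₀ w, ← card_eq_card_mul_card_inf_ker ξ hw₁ hξw,
        ← ih _ (hlt w) (U₁ w) ⟨w, hw₁, hξw⟩ ?_ rfl]
      · exact Nat.card_congr ((Equiv.subtypeSubtypeEquivSubtypeInter _ fun x => T w + x ∈ U).trans
          (Equiv.subtypeEquivRight (hiff w hw hξw)))
      · rw [hU₀]
        exact h.mono inf_le_left
    · rintro ⟨x, hx⟩
      simp only [NoInvariant, not_forall] at hx
      obtain ⟨W, hWU, hW, hW0⟩ := hx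
      obtain ⟨y, hy, hy1⟩ := exists_mem_eq_one h x hWU hW hW0
      have hyU : T y + x ∈ U := by simpa [hy1] using hWU (hW hy)
      exact Nat.card_congr
        { toFun := fun w => ⟨w.1 - y, ⟨U.sub_mem w.1.2.1 (hWU hy), by simp [hy1, w.1.2.2]⟩, by
            have := U.sub_mem w.2 hyU
            simpa using this⟩
          invFun := fun u => ⟨⟨u + y, U.add_mem u.2.1.1 (hWU hy), by
            have : ξ u = 0 := u.2.1.2
            simp [this, hy1]⟩, by
            have := U.add_mem u.2.2 hyU
            simpa [add_assoc] using this⟩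
          left_inv := fun w => by simp
          right_inv := fun u => by simp }

end NoInvariant

section Extensions

open Polynomial Module

variable {K V : Type*} [Field K] [AddCommGroup V] [Module K V] [FiniteDimensional K V]

theorem exists_aeval_apply_eq {f : K[X]} (hf : Irreducible f) (hdeg : f.natDegree = finrank K V)
    {T : V →ₗ[K] V} {w : V} (hw : w ≠ 0) (h : aeval T f w = 0) (v : V) :
    ∃ p : K[X], aeval T p w = v := by
  let φ : K[X]_(finrank K V) →ₗ[K] V :=
    LinearMap.applyₗ w ∘ₗ (aeval T).toLinearMap ∘ₗ Submodule.subtype _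
  have : FiniteDimensional K K[X]_(finrank K V) :=
    Module.Finite.equiv (degreeLTEquiv K (finrank K V)).symm
  have hfin : finrank K K[X]_(finrank K V) = finrank K V := by
    rw [(degreeLTEquiv K (finrank K V)).finrank_eq, finrank_fin_fun]
  have hinj : Function.Injective φ := by
    rw [injective_iff_map_eq_zero]
    rintro ⟨p, hp⟩ hφ
    have hpw : aeval T p w = 0 := hφ
    rw [mem_degreeLT, ← hdeg, ← degree_eq_natDegree hf.ne_zero] at hp
    by_contra hp0
    have hp0 : p ≠ 0 := fun h => hp0 (by ext1; exact h)
    obtain ⟨a, c, hac⟩ := (hf.coprime_iff_not_dvd).2 (fun hd => hp.not_ge (degree_le_of_dvd hd hp0))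
    apply hw
    have := congrArg (fun g => aeval T g w) hac
    simpa [h, hpw] using this.symm
  obtain ⟨p, hp⟩ := (LinearMap.injective_iff_surjective_of_finrank_eq_finrank hfin).1 hinj v
  exact ⟨p, hp⟩

theorem noInvariant_of_aeval_eq_zero {f : K[X]} (hf : Irreducible f)
    (hdeg : f.natDegree = finrank K V) {T : V →ₗ[K] V} (h : aeval T f = 0) {U : Submodule K V}
    (hU : U ≠ ⊤) : NoInvariant T U := by
  intro W hWU hW
  by_contra hW0
  obtain ⟨w, hw, hw0⟩ := W.exists_mem_ne_zero_of_ne_bot hW0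
  refine hU (eq_top_iff.2 fun v _ => ?_)
  obtain ⟨p, rfl⟩ := exists_aeval_apply_eq (T := T) hf hdeg hw0 (by simp [h]) v
  clear * - hWU hw hW
  refine hWU ?_
  induction p using Polynomial.induction_on' with
  | add p q hp hq => simpa using W.add_mem hp hq
  | monomial n a =>
    rw [aeval_monomial, Module.End.mul_apply, Module.algebraMap_end_apply]
    refine W.smul_mem a ?_
    induction n with
    | zero => simpa using hw
    | succ n ih =>
      rw [pow_succ', Module.End.mul_apply]
      exact hW ih

/-- A polynomial of degree `finrank K V` that is monic and irreducible annihilates exactly one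
rank one update `T + ξ ⊗ x`, provided `ker ξ` contains no nonzero `T`-invariant subspace. -/
theorem existsUnique_aeval_update_eq_zero {f : K[X]} (hf : Irreducible f) (hmon : f.Monic)
    (hdeg : f.natDegree = finrank K V) {T : V →ₗ[K] V} {ξ : V →ₗ[K] K}
    (h : NoInvariant T (LinearMap.ker ξ)) : ∃! x, aeval (T + ξ.smulRight x) f = 0 := by
  obtain ⟨n, hn⟩ := Nat.exists_eq_succ_of_ne_zero (hdeg ▸ hf.natDegree_pos.ne')
  obtain ⟨w, hwker, hw0⟩ := Submodule.exists_mem_ne_zero_of_ne_bot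
    (LinearMap.ker_ne_bot_of_finrank_lt
      (f := LinearMap.pi fun i : Fin n => ξ ∘ₗ (T ^ (i : ℕ))) (by simp [hn]))
  have hw : ∀ i < n, ξ ((T ^ i) w) = 0 := fun i hi => congrFun (LinearMap.mem_ker.1 hwker) ⟨i, hi⟩
  have hn0 : ξ ((T ^ n) w) ≠ 0 := by
    intro hn0
    let φ : K[X] →ₗ[K] V := LinearMap.applyₗ w ∘ₗ (aeval T).toLinearMap
    have hφ : ∀ p, φ p = aeval T p w := fun p => rfl
    have hbot := h (LinearMap.range φ) ?_ ?_
    · apply hw0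
      have : φ 1 = 0 := by
        rw [← Submodule.mem_bot K, ← hbot]
        exact ⟨1, rfl⟩
      simpa [hφ] using this
    · rintro _ ⟨p, rfl⟩
      have hlt : (p %ₘ T.charpoly).natDegree < n + 1 := by
        rw [← Nat.succ_eq_add_one, ← hn, ← LinearMap.charpoly_natDegree T]
        refine natDegree_modByMonic_lt _ T.charpoly_monic fun h1 => ?_
        have := LinearMap.charpoly_natDegree T
        simp [h1, hn] at this
      rw [LinearMap.mem_ker, hφ, ← modByMonic_add_div p T.charpoly, map_add, map_mul,
        LinearMap.aeval_self_charpoly, zero_mul, add_zero, aeval_eq_sum_range' hlt]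
      simp only [LinearMap.sum_apply, LinearMap.smul_apply, map_sum, map_smul]
      refine Finset.sum_eq_zero fun i hi => ?_
      rcases (Finset.mem_range_succ_iff.1 hi).lt_or_eq with hi | rfl
      · simp [hw i hi]
      · simp [hn0]
    · rintro _ ⟨p, rfl⟩
      exact ⟨X * p, by simp [hφ]⟩
  have hpow : ∀ x, ∀ i ≤ n, ((T + ξ.smulRight x : V →ₗ[K] V) ^ i) w = (T ^ i) w := by
    intro x i
    induction i with
    | zero => simp
    | succ i ih =>
      intro hi
      rw [pow_succ', Module.End.mul_apply, ih (by omega), pow_succ', Module.End.mul_apply]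
      simp [hw i (by omega)]
  have hval : ∀ x, aeval (T + ξ.smulRight x : V →ₗ[K] V) f w = aeval T f w + ξ ((T ^ n) w) • x := by
    intro x
    have hc : f.coeff (n + 1) = 1 := by
      rw [← Nat.succ_eq_add_one, ← hn, ← hdeg]
      exact hmon
    rw [aeval_eq_sum_range, aeval_eq_sum_range, hdeg, hn, Finset.sum_range_succ,
      Finset.sum_range_succ _ n.succ, Nat.succ_eq_add_one, hc]
    simp only [LinearMap.add_apply, LinearMap.sum_apply, LinearMap.smul_apply, one_smul]
    rw [pow_succ', Module.End.mul_apply, hpow x n le_rfl, pow_succ' T, Module.End.mul_apply,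
      Finset.sum_congr rfl fun i hi => by rw [hpow x i (Finset.mem_range_succ_iff.1 hi)]]
    simp [add_assoc]
  have hiff : ∀ x, aeval (T + ξ.smulRight x) f = 0 ↔
      x = -((ξ ((T ^ n) w))⁻¹ • aeval T f w) := by
    intro x
    have h1 : aeval (T + ξ.smulRight x) f = 0 ↔ aeval (T + ξ.smulRight x : V →ₗ[K] V) f w = 0 := by
      refine ⟨fun h0 => by simp [h0], fun h0 => LinearMap.ext fun v => ?_⟩
      obtain ⟨p, rfl⟩ := exists_aeval_apply_eq hf hdeg hw0 h0 v
      rw [← Module.End.mul_apply, ← map_mul, mul_comm, map_mul, Module.End.mul_apply, h0]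
      simp
    rw [h1, hval, ← smul_neg, eq_inv_smul_iff₀ hn0, add_comm, eq_neg_iff_add_eq_zero]
  exact ⟨_, (hiff _).2 rfl, fun x hx => (hiff x).1 hx⟩

theorem charpoly_eq_iff_aeval_eq_zero {f : K[X]} (hf : Irreducible f) (hmon : f.Monic)
    (hdeg : f.natDegree = finrank K V) (T : V →ₗ[K] V) : T.charpoly = f ↔ aeval T f = 0 := by
  refine ⟨fun h => h ▸ T.aeval_self_charpoly, fun h => ?_⟩
  have : Nontrivial V := nontrivial_of_finrank_pos (R := K) (hdeg ▸ hf.natDegree_pos)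
  have hmin := minpoly.eq_of_irreducible_of_monic hf h hmon
  exact eq_of_monic_of_dvd_of_natDegree_le hmon T.charpoly_monic (hmin ▸ T.minpoly_dvd_charpoly)
    (by rw [T.charpoly_natDegree, hdeg])

open Submodule in
theorem exists_dual_of_ne_top {U : Submodule K V} (hU : U ≠ ⊤) :
    ∃ (v : V) (ξ : V →ₗ[K] K), ξ v = 1 ∧
      finrank K (U ⊔ K ∙ v : Submodule K V) = finrank K U + 1 ∧
      (U ⊔ K ∙ v) ⊓ LinearMap.ker ξ = U ∧
      ∀ (T : V →ₗ[K] V) (x : V) (S : V →ₗ[K] V), ((∀ u ∈ U, S u = T u) ∧ S v = T v + x) ↔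
        ∀ u ∈ U ⊔ K ∙ v, S u = (T + ξ.smulRight x) u := by
  obtain ⟨v, -, hv⟩ := SetLike.exists_of_lt hU.lt_top
  obtain ⟨ξ, hξv, hξU⟩ : ∃ ξ : V →ₗ[K] K, ξ v = 1 ∧ U ≤ LinearMap.ker ξ := by
    obtain ⟨ξ, hξv, hξU⟩ := exists_le_ker_of_notMem hv
    refine ⟨(ξ v)⁻¹ • ξ, by simp [hξv], fun u hu => ?_⟩
    have : ξ u = 0 := hξU hu
    simp [this]
  refine ⟨v, ξ, hξv, finrank_sup_span_singleton hv, ?_, fun T x S => ⟨?_, fun h1 => ⟨?_, ?_⟩⟩⟩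
  · rw [sup_inf_assoc_of_le _ hξU, sup_eq_left]
    rintro u ⟨hu, hu0⟩
    obtain ⟨c, rfl⟩ := mem_span_singleton.1 hu
    have hc : c = 0 := by simpa [hξv] using hu0
    simp [hc]
  · rintro ⟨h1, h2⟩ u hu
    obtain ⟨y, hy, z, hz, rfl⟩ := mem_sup.1 hu
    obtain ⟨c, rfl⟩ := mem_span_singleton.1 hz
    have hy0 : ξ y = 0 := hξU hy
    simp [h1 y hy, h2, hξv, hy0, add_assoc]
  · intro u hu
    have hu0 : ξ u = 0 := hξU hu
    simpa [hu0] using h1 u (mem_sup_left hu)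
  · simpa [hξv] using h1 v (mem_sup_right (mem_span_singleton_self v))

variable [Finite V]

open Submodule in
/-- If `U` has codimension `m + 1` and contains no nonzero `T`-invariant subspace, this is the
number of endomorphisms that agree with `T` on `U` and have characteristic polynomial `f`, for any
irreducible `f`. -/
theorem card_extensions {f : K[X]} (hf : Irreducible f) (hmon : f.Monic)
    (hdeg : f.natDegree = finrank K V) (m : ℕ) (U : Submodule K V) (T : V →ₗ[K] V)
    (h : NoInvariant T U) (hU : finrank K U + (m + 1) = finrank K V) :
    Nat.card {S : V →ₗ[K] V // (∀ u ∈ U, S u = T u) ∧ aeval S f = 0} =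
      ∏ i ∈ Finset.range m, (Nat.card K ^ finrank K V - Nat.card K ^ (finrank K V - (i + 1))) := by
  have : Finite (V →ₗ[K] V) := DFunLike.finite _
  induction m generalizing U T with
  | zero =>
    obtain ⟨v, ξ, hξv, hdim, hker, hagree⟩ := exists_dual_of_ne_top (U := U) (by
      rintro rfl
      rw [finrank_top] at hU
      omega)
    have htop : U ⊔ K ∙ v = ⊤ := Submodule.eq_top_of_finrank_eq (by omega)
    rw [htop, top_inf_eq] at hker
    obtain ⟨x, hx, hxu⟩ := existsUnique_aeval_update_eq_zero hf hmon hdeg (hker ▸ h)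
    rw [Finset.prod_range_zero, Nat.card_eq_one_iff_exists]
    have hS : ∀ (y : V) (S : V →ₗ[K] V), ((∀ u ∈ U, S u = T u) ∧ S v = T v + y) ↔
        S = T + ξ.smulRight y := fun y S => by
      rw [hagree, htop, LinearMap.ext_iff]
      simp
    refine ⟨⟨T + ξ.smulRight x, ((hS x _).2 rfl).1, hx⟩, ?_⟩
    rintro ⟨S, hSU, hSf⟩
    have hS' := (hS (S v - T v) S).1 ⟨hSU, by simp⟩
    rw [hS'] at hSf
    rw [Subtype.mk.injEq, hS', hxu _ hSf]
  | succ m ih =>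
    obtain ⟨v, ξ, hξv, hdim, hker, hagree⟩ := exists_dual_of_ne_top (U := U) (by
      rintro rfl
      rw [finrank_top] at hU
      omega)
    have hcount := Nat.card_mul_eq_card_mul_of_forall
      (fun (S : {S : V →ₗ[K] V // (∀ u ∈ U, S u = T u) ∧ aeval S f = 0})
        (x : {x // NoInvariant (T + ξ.smulRight x) (U ⊔ K ∙ v)}) => S.1 v = T v + x.1)
      (m := 1) (n := ∏ i ∈ Finset.range m,
        (Nat.card K ^ finrank K V - Nat.card K ^ (finrank K V - (i + 1)))) ?_ ?_
    · have hbad := card_not_noInvariant_update T ξ (U ⊔ K ∙ v)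
        ⟨v, mem_sup_right (mem_span_singleton_self v), hξv⟩ (hker.symm ▸ h)
      classical
      have hsum := Nat.card_congr
        (Equiv.sumCompl fun x => NoInvariant (T + ξ.smulRight x) (U ⊔ K ∙ v))
      rw [Nat.card_sum, hbad, natCard_eq_pow_finrank (K := K) (V := V),
        natCard_eq_pow_finrank (K := K) (V := (U ⊔ K ∙ v : Submodule K V)), hdim] at hsum
      rw [mul_one] at hcount
      rw [hcount, Finset.prod_range_succ, mul_comm, Nat.eq_sub_of_add_eq hsum]
      congr 3
      omega
    · rintro ⟨S, hSU, hSf⟩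
      rw [Nat.card_eq_one_iff_exists]
      have hagr := (hagree T (S v - T v) S).1 ⟨hSU, by simp⟩
      refine ⟨⟨⟨S v - T v, ?_⟩, by simp⟩, ?_⟩
      · refine (noInvariant_of_aeval_eq_zero hf hdeg hSf fun htop => ?_).congr
          fun u hu => (hagr u hu).symm
        rw [htop, finrank_top] at hdim
        omega
      · rintro ⟨⟨x, hx⟩, hx'⟩
        simp only [Subtype.mk.injEq]
        exact eq_sub_of_add_eq' hx'.symm
    · rintro ⟨x, hx⟩
      rw [← ih (U ⊔ K ∙ v) (T + ξ.smulRight x) hx (by omega)]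
      refine Nat.card_congr ((Equiv.subtypeSubtypeEquivSubtypeInter _
        fun S : V →ₗ[K] V => S v = T v + x).trans (Equiv.subtypeEquivRight fun S => ?_))
      rw [← hagree]
      tauto

end Extensions

section PrimitivePolynomials

open Polynomial Module

instance finite_isPrimitivePoly (n : ℕ) : Finite {p // IsPrimitivePoly n p} := by
  refine Finite.of_injective (β := Fin (n + 1) → ZMod 2) (fun p i => p.1.coeff i) ?_
  rintro ⟨p, _, hp, _⟩ ⟨q, _, hq, _⟩ h
  refine Subtype.ext (Polynomial.ext fun i => ?_)
  by_cases hi : i < n + 1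
  · exact congrFun h ⟨i, hi⟩
  · change p.coeff i = q.coeff i
    rw [coeff_eq_zero_of_natDegree_lt (by omega), coeff_eq_zero_of_natDegree_lt (by omega)]

theorem orderOf_root_eq_of_aeval_eq_zero {F E : Type*} [Field F] [Field E] [Algebra F E]
    {p : F[X]} (hp : Irreducible p) {x : E} (hx : aeval x p = 0) :
    orderOf (AdjoinRoot.root p) = orderOf x := by
  have : Fact (Irreducible p) := ⟨hp⟩
  let φ := AdjoinRoot.liftAlgHom p (Algebra.ofId F E) x (by simpa [aeval_def] using hx)
  have hφ : φ (AdjoinRoot.root p) = x := by simp [φ]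
  rw [← hφ]
  exact (orderOf_injective (φ : AdjoinRoot p →* E) φ.injective _).symm

theorem natDegree_minpoly_of_orderOf {F E : Type*} [Field F] [Finite F] [Field E] [Finite E]
    [Algebra F E] {x : E} (hx : orderOf x = Nat.card E - 1) (hx0 : x ≠ 0) :
    (minpoly F x).natDegree = finrank F E := by
  have hint : IsIntegral F x := Algebra.IsIntegral.isIntegral x
  rw [← IntermediateField.adjoin.finrank hint]
  have hcard : Nat.card E ≤ Nat.card (IntermediateField.adjoin F {x}) := by
    let g : IntermediateField.adjoin F {x} := IntermediateField.AdjoinSimple.gen F x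
    have hg0 : g ≠ 0 := fun h => hx0 (by simpa [g] using congrArg Subtype.val h)
    have hg : g ^ (Nat.card (IntermediateField.adjoin F {x}) - 1) = 1 := by
      have := Fintype.ofFinite (IntermediateField.adjoin F {x})
      rw [Nat.card_eq_fintype_card]
      exact FiniteField.pow_card_sub_one_eq_one g hg0
    have hx1 : x ^ (Nat.card (IntermediateField.adjoin F {x}) - 1) = 1 := by
      simpa [g] using congrArg Subtype.val hg
    have h2 : 1 < Nat.card (IntermediateField.adjoin F {x}) := Finite.one_lt_card
    have := orderOf_le_of_pow_eq_one (by omega) hx1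
    omega
  refine le_antisymm (IntermediateField.finrank_le_of_le_right le_top |>.trans_eq ?_) ?_
  · exact IntermediateField.finrank_top'
  · rw [natCard_eq_pow_finrank (K := F) (V := E),
      natCard_eq_pow_finrank (K := F) (V := IntermediateField.adjoin F {x})] at hcard
    exact (Nat.pow_le_pow_iff_right Finite.one_lt_card).1 hcard

theorem card_orderOf_eq_card_sub_one (E : Type*) [Field E] [Finite E] :
    Nat.card {x : E // orderOf x = Nat.card E - 1} = Nat.totient (Nat.card E - 1) := by
  classical
  have := Fintype.ofFinite E
  have hu : Fintype.card Eˣ = Nat.card E - 1 := by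
    rw [Fintype.card_units, Nat.card_eq_fintype_card]
  rw [← IsCyclic.card_orderOf_eq_totient (α := Eˣ) (d := Nat.card E - 1) (by rw [hu]),
    ← Fintype.card_subtype, ← Nat.card_eq_fintype_card]
  have h1 : 1 < Nat.card E := Finite.one_lt_card
  refine Nat.card_congr (Equiv.symm (Equiv.ofBijective
    (fun u => ⟨(u.1 : E), by rw [orderOf_units, u.2]⟩) ⟨?_, ?_⟩))
  · rintro ⟨u, hu⟩ ⟨v, hv⟩ h
    simpa [Units.ext_iff] using h
  · rintro ⟨x, hx⟩
    have hx0 : x ≠ 0 := by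
      rintro rfl
      rw [orderOf_zero] at hx
      omega
    exact ⟨⟨Units.mk0 x hx0, by rw [← orderOf_units, ← hx, Units.val_mk0]⟩, by simp⟩

theorem card_isPrimitivePoly_mul {n : ℕ} (hn : n ≠ 0) :
    Nat.card {p // IsPrimitivePoly n p} * n = Nat.totient (2 ^ n - 1) := by
  have hcard : Nat.card (GaloisField 2 n) = 2 ^ n := GaloisField.card 2 n hn
  have h2 : 2 ≤ 2 ^ n := Nat.le_self_pow hn 2
  have hcount := Nat.card_mul_eq_card_mul_of_forall
    (fun (p : {p // IsPrimitivePoly n p})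
      (x : {x : GaloisField 2 n // orderOf x = Nat.card (GaloisField 2 n) - 1}) => aeval x.1 p.1 = 0)
    (m := n) (n := 1) ?_ ?_
  · rw [hcount, mul_one, card_orderOf_eq_card_sub_one, hcard]
  · rintro ⟨p, hmon, hdeg, hirr, hord⟩
    have : Fact (Irreducible p) := ⟨hirr⟩
    obtain ⟨φ⟩ : Nonempty (AdjoinRoot p →ₐ[ZMod 2] GaloisField 2 n) := by
      rw [FiniteField.nonempty_algHom_iff_finrank_dvd, GaloisField.finrank 2 hn,
        (AdjoinRoot.powerBasis hirr.ne_zero).finrank, AdjoinRoot.powerBasis_dim, hdeg]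
    have hroot : aeval (φ (AdjoinRoot.root p)) p = 0 := by
      rw [aeval_algHom_apply]
      simp
    have hsplit : (p.map (algebraMap (ZMod 2) (GaloisField 2 n))).Splits := by
      rw [minpoly.eq_of_irreducible_of_monic hirr hroot hmon]
      exact Normal.splits inferInstance _
    have hroots := card_rootSet_eq_natDegree (PerfectField.separable_of_irreducible hirr) hsplit
    rw [← Nat.card_eq_fintype_card, hdeg] at hroots
    refine Eq.trans (Nat.card_congr ((Equiv.subtypeSubtypeEquivSubtypeInter _
      fun x : GaloisField 2 n => aeval x p = 0).trans (Equiv.subtypeEquivRight fun x => ?_))) hroots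
    rw [mem_rootSet, hcard]
    refine ⟨fun h => ⟨hirr.ne_zero, h.2⟩, fun h => ⟨?_, h.2⟩⟩
    rw [← orderOf_root_eq_of_aeval_eq_zero hirr h.2, hord]
  · rintro ⟨x, hx⟩
    have hint : IsIntegral (ZMod 2) x := Algebra.IsIntegral.isIntegral x
    have hirr := minpoly.irreducible hint
    have hx0 : x ≠ 0 := by
      rintro rfl
      rw [orderOf_zero] at hx
      omega
    rw [Nat.card_eq_one_iff_exists]
    refine ⟨⟨⟨minpoly (ZMod 2) x, minpoly.monic hint, ?_, hirr, ?_⟩, minpoly.aeval _ _⟩, ?_⟩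
    · rw [natDegree_minpoly_of_orderOf hx hx0, GaloisField.finrank 2 hn]
    · rw [orderOf_root_eq_of_aeval_eq_zero hirr (minpoly.aeval _ x), hx, hcard]
    · rintro ⟨⟨p, hmon, _, hp, _⟩, hpx⟩
      refine Subtype.ext (Subtype.ext ?_)
      exact minpoly.eq_of_irreducible_of_monic hp hpx hmon

end PrimitivePolynomials

section MCompanion

open Module

/-- The block shift sending the basis vector `(i, k)` to `(i + 1, k)`, and those of the last block
to `0`. -/
def blockShift (K : Type*) [Field K] (m b : ℕ) :
    (Fin b × Fin m → K) →ₗ[K] (Fin b × Fin m → K) :=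
  Matrix.toLin' (Matrix.of fun p q => if (p.1 : ℕ) = (q.1 : ℕ) + 1 ∧ q.2 = p.2 then 1 else 0)

/-- The vectors whose last block vanishes. -/
def lastBlockKer (K : Type*) [Field K] (m c : ℕ) : Submodule K (Fin (c + 1) × Fin m → K) :=
  LinearMap.ker (LinearMap.funLeft K K fun k => (Fin.last c, k))

theorem mem_lastBlockKer {K : Type*} [Field K] {m c : ℕ} {v : Fin (c + 1) × Fin m → K} :
    v ∈ lastBlockKer K m c ↔ ∀ k, v (Fin.last c, k) = 0 := by
  simp [lastBlockKer, funext_iff, LinearMap.funLeft_apply]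

theorem finrank_lastBlockKer (K : Type*) [Field K] (m c : ℕ) :
    finrank K (lastBlockKer K m c) + m = finrank K (Fin (c + 1) × Fin m → K) := by
  rw [← LinearMap.finrank_range_add_finrank_ker (LinearMap.funLeft K K fun k => (Fin.last c, k)),
    LinearMap.range_eq_top.2 (LinearMap.funLeft_surjective_of_injective _ _ _ fun k l h => by
      simpa using h), finrank_top, finrank_fin_fun, add_comm, lastBlockKer]

theorem blockShift_apply_succ {K : Type*} [Field K] {m c : ℕ} (v : Fin (c + 1) × Fin m → K)
    (i : Fin c) (k : Fin m) : blockShift K m (c + 1) v (i.succ, k) = v (i.castSucc, k) := by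
  rw [blockShift, Matrix.toLin'_apply, Matrix.mulVec, dotProduct,
    Finset.sum_eq_single (i.castSucc, k)]
  · simp
  · rintro ⟨j, l⟩ - hne
    rw [Matrix.of_apply, if_neg, zero_mul]
    rintro ⟨h1, h2⟩
    refine hne (Prod.ext (Fin.ext ?_) h2)
    simpa using h1.symm
  · simp

theorem noInvariant_blockShift (K : Type*) [Field K] (m c : ℕ) :
    NoInvariant (blockShift K m (c + 1)) (lastBlockKer K m c) := by
  intro W hWU hW
  have key : ∀ i : Fin (c + 1), ∀ w ∈ W, ∀ k, w (i, k) = 0 := by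
    intro i
    induction i using Fin.reverseInduction with
    | last => exact fun w hw => mem_lastBlockKer.1 (hWU hw)
    | cast i ih => exact fun w hw k => blockShift_apply_succ w i k ▸ ih _ (hW hw) k
  exact (Submodule.eq_bot_iff _).2 fun w hw => funext fun p => key p.1 w hw p.2

theorem mCompanionForm_iff {m c : ℕ}
    (C : Matrix (Fin (c + 1) × Fin m) (Fin (c + 1) × Fin m) (ZMod 2)) :
    MCompanionForm m (c + 1) C ↔
      ∀ u ∈ lastBlockKer (ZMod 2) m c, Matrix.toLin' Cᵀ u = blockShift (ZMod 2) m (c + 1) u := by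
  constructor
  · intro h u hu
    rw [blockShift, Matrix.toLin'_apply, Matrix.toLin'_apply]
    ext ⟨j, l⟩
    refine Finset.sum_congr rfl ?_
    rintro ⟨i, k⟩ -
    induction i using Fin.lastCases with
    | last => rw [mem_lastBlockKer.1 hu, mul_zero, mul_zero]
    | cast i => simp [h i.castSucc (by simp) k j l]
  · intro h i hi k j l
    have hu : Pi.single (i, k) 1 ∈ lastBlockKer (ZMod 2) m c := mem_lastBlockKer.2 fun k' =>
      Pi.single_eq_of_ne (fun he => by
        have : (Fin.last c : ℕ) = i := congrArg (fun p => (p.1 : ℕ)) he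
        simp at this
        omega) _
    have := congrFun (h _ hu) (j, l)
    simpa [blockShift, Matrix.toLin'_apply] using this

theorem card_mCompanionForm_charpoly_eq {m c : ℕ} {f : Polynomial (ZMod 2)} (hf : Irreducible f)
    (hmon : f.Monic) (hdeg : f.natDegree = (m + 1) * (c + 1)) :
    Nat.card {C : Matrix (Fin (c + 1) × Fin (m + 1)) (Fin (c + 1) × Fin (m + 1)) (ZMod 2) //
        MCompanionForm (m + 1) (c + 1) C ∧ C.charpoly = f} =
      ∏ i ∈ Finset.range m, (2 ^ ((m + 1) * (c + 1)) - 2 ^ ((m + 1) * (c + 1) - (i + 1))) := by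
  have hfin : finrank (ZMod 2) (Fin (c + 1) × Fin (m + 1) → ZMod 2) = (m + 1) * (c + 1) := by
    simp [mul_comm]
  have hcard := card_extensions hf hmon (hdeg.trans hfin.symm) m _ _
    (noInvariant_blockShift (ZMod 2) (m + 1) c) (finrank_lastBlockKer (ZMod 2) (m + 1) c)
  rw [hfin, Nat.card_zmod] at hcard
  rw [← hcard]
  refine Nat.card_congr (Equiv.subtypeEquiv ((Matrix.transposeAddEquiv _ _ _).toEquiv.trans
    Matrix.toLin'.toEquiv) fun C => and_congr (mCompanionForm_iff C) ?_)
  rw [← charpoly_eq_iff_aeval_eq_zero hf hmon (hdeg.trans hfin.symm), ← C.charpoly_transpose,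
    ← Matrix.charpoly_toLin']
  rfl

theorem prod_two_pow_sub (m c : ℕ) :
    (∏ i ∈ Finset.range m, (2 ^ ((m + 1) * (c + 1)) - 2 ^ ((m + 1) * (c + 1) - (i + 1)))) *
        (2 ^ (m + 1) - 1) =
      (∏ i ∈ Finset.range (m + 1), (2 ^ (m + 1) - 2 ^ i)) * 2 ^ ((m + 1) * m * c) := by
  have h : ∀ i ∈ Finset.range m,
      2 ^ ((m + 1) * (c + 1)) - 2 ^ ((m + 1) * (c + 1) - (i + 1)) =
        2 ^ ((m + 1) * c) * (2 ^ (m + 1) - 2 ^ (m - 1 - i + 1)) := fun i hi => by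
    have hi := Finset.mem_range.1 hi
    rw [Nat.mul_sub, ← pow_add, ← pow_add, mul_add, mul_one,
      show (m + 1) * c + (m + 1) - (i + 1) = (m + 1) * c + (m - 1 - i + 1) by omega]
  rw [Finset.prod_congr rfl h, Finset.prod_mul_distrib, Finset.prod_const, Finset.card_range,
    Finset.prod_range_reflect (fun i => 2 ^ (m + 1) - 2 ^ (i + 1)), Finset.prod_range_succ',
    ← pow_mul, pow_zero, mul_right_comm (m + 1) c m]
  ring

end MCompanion

/-- If `N` is the number of `n × n` matrices over `ZMod 2` (`n = m·b`) in
M-companion form with primitive characteristic polynomial, then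
`N · n · (2^m - 1) = |GL(m, F₂)| · φ(2^n - 1) · 2^{m(m-1)(b-1)}`. -/
theorem card_MCompanion_primitive
    (m b : ℕ) (hm : 1 ≤ m) (hb : 1 ≤ b) :
    Nat.card {Cm : Matrix (Fin b × Fin m) (Fin b × Fin m) (ZMod 2) //
        MCompanionForm m b Cm ∧ IsPrimitivePoly (m*b) (Matrix.charpoly Cm)}
        * (m*b) * (2^m - 1)
      = (∏ i ∈ Finset.range m, (2^m - 2^i)) * Nat.totient (2^(m*b) - 1)
        * 2^(m*(m-1)*(b-1)) := by

  obtain ⟨m, rfl⟩ := Nat.exists_eq_add_of_le' hm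
  obtain ⟨c, rfl⟩ := Nat.exists_eq_add_of_le' hb
  have hcount := Nat.card_mul_eq_card_mul_of_forall
    (fun (C : {C : Matrix (Fin (c + 1) × Fin (m + 1)) (Fin (c + 1) × Fin (m + 1)) (ZMod 2) //
        MCompanionForm (m + 1) (c + 1) C ∧ IsPrimitivePoly ((m + 1) * (c + 1)) C.charpoly})
      (p : {p // IsPrimitivePoly ((m + 1) * (c + 1)) p}) => C.1.charpoly = p.1)
    (m := 1) (n := ∏ i ∈ Finset.range m,
      (2 ^ ((m + 1) * (c + 1)) - 2 ^ ((m + 1) * (c + 1) - (i + 1)))) ?_ ?_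
  · rw [mul_one] at hcount
    rw [hcount, ← card_isPrimitivePoly_mul (n := (m + 1) * (c + 1)) (by positivity),
      Nat.add_sub_cancel, Nat.add_sub_cancel]
    linear_combination
      Nat.card {p // IsPrimitivePoly ((m + 1) * (c + 1)) p} * ((m + 1) * (c + 1)) *
        prod_two_pow_sub m c
  · rintro ⟨C, hC, hp⟩
    rw [Nat.card_eq_one_iff_exists]
    exact ⟨⟨⟨_, hp⟩, rfl⟩, fun q => Subtype.ext (Subtype.ext q.2.symm)⟩
  · rintro ⟨p, hp⟩
    rw [← card_mCompanionForm_charpoly_eq hp.2.2.1 hp.1 hp.2.1]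
    refine Nat.card_congr ((Equiv.subtypeSubtypeEquivSubtypeInter _
      fun C : Matrix (Fin (c + 1) × Fin (m + 1)) (Fin (c + 1) × Fin (m + 1)) (ZMod 2) =>
        C.charpoly = p).trans (Equiv.subtypeEquivRight fun C => ?_))
    exact ⟨fun h => ⟨h.1.1, h.2⟩, fun h => ⟨⟨h.1, h.2 ▸ hp⟩, h.2⟩⟩
end
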